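/- The censoring adjustment function h satisfies lim_{z → +∞} h(z) = 1. -/

import Mathlib

open MeasureTheory Real Filter

/-- The standard normal density. -/
noncomputable def normPDF (t : ℝ) : ℝ := Real.exp (-t ^ 2 / 2) / Real.sqrt (2 * Real.pi)

/-- The standard normal cumulative distribution function. -/
noncomputable def normCDF (t : ℝ) : ℝ := ∫ s in Set.Iic t, normPDF s

/-- The censoring adjustment function `h(z) = Φ(z) − z·φ(z) + φ(z)²/(1 − Φ(z))`. -/
noncomputable def censorAdj (z : ℝ) : ℝ :=
  normCDF z - z * normPDF z + (normPDF z) ^ 2 / (1 - normCDF z)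

theorem normPDF_eq_gaussianPDFReal : normPDF = ProbabilityTheory.gaussianPDFReal 0 1 := by
  funext t
  simp [normPDF, ProbabilityTheory.gaussianPDFReal, div_eq_inv_mul]

theorem normPDF_pos (t : ℝ) : 0 < normPDF t := by
  unfold normPDF
  positivity

theorem integrable_normPDF : Integrable normPDF := by
  rw [normPDF_eq_gaussianPDFReal]
  exact ProbabilityTheory.integrable_gaussianPDFReal 0 1

theorem integral_normPDF : ∫ t, normPDF t = 1 := by
  rw [normPDF_eq_gaussianPDFReal]
  exact ProbabilityTheory.integral_gaussianPDFReal_eq_one 0 one_ne_zero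

theorem normPDF_le_of_nonneg_of_le {s t : ℝ} (hs : 0 ≤ s) (hst : s ≤ t) :
    normPDF t ≤ normPDF s := by
  unfold normPDF
  gcongr

theorem normCDF_tendsto_atTop : Tendsto normCDF atTop (nhds 1) := by
  rw [← integral_normPDF]
  exact (aecover_Iic (μ := volume) tendsto_id).integral_tendsto_of_countably_generated
    integrable_normPDF

theorem one_sub_normCDF (z : ℝ) : 1 - normCDF z = ∫ t in Set.Ioi z, normPDF t := by
  rw [← integral_normPDF, normCDF, ← intervalIntegral.integral_Iic_add_Ioi (b := z)
    integrable_normPDF.integrableOn integrable_normPDF.integrableOn]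
  ring

theorem normPDF_add_one_le_one_sub_normCDF {z : ℝ} (hz : 0 ≤ z) :
    normPDF (z + 1) ≤ 1 - normCDF z := by
  rw [one_sub_normCDF]
  calc normPDF (z + 1) = ∫ _ in Set.Ioc z (z + 1), normPDF (z + 1) := by simp
    _ ≤ ∫ t in Set.Ioc z (z + 1), normPDF t :=
      setIntegral_mono_on (by simp) integrable_normPDF.integrableOn measurableSet_Ioc
        fun t ht => normPDF_le_of_nonneg_of_le (hz.trans ht.1.le) ht.2
    _ ≤ ∫ t in Set.Ioi z, normPDF t :=
      setIntegral_mono_set integrable_normPDF.integrableOn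
        (Eventually.of_forall fun t => (normPDF_pos t).le)
        (Set.Ioc_subset_Ioi_self).eventuallyLE

theorem normPDF_sq (z : ℝ) :
    normPDF z ^ 2 = Real.exp 1 * normPDF (z - 1) * normPDF (z + 1) := by
  have h : Real.exp (-z ^ 2 / 2) ^ 2
      = Real.exp 1 * Real.exp (-(z - 1) ^ 2 / 2) * Real.exp (-(z + 1) ^ 2 / 2) := by
    rw [← Real.exp_nat_mul, ← Real.exp_add, ← Real.exp_add]
    congr 1
    push_cast
    ring
  unfold normPDF
  rw [div_pow, h]
  ring

theorem mul_normPDF_tendsto_atTop : Tendsto (fun z => z * normPDF z) atTop (nhds 0) := by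
  have h := (Real.tendsto_pow_mul_exp_neg_atTop_nhds_zero 1).div_const (Real.sqrt (2 * Real.pi))
  rw [zero_div] at h
  refine squeeze_zero' ?_ ?_ h
  · filter_upwards [eventually_ge_atTop 0] with z hz
    exact mul_nonneg hz (normPDF_pos z).le
  · filter_upwards [eventually_ge_atTop 2] with z hz
    rw [normPDF, pow_one, mul_div_assoc]
    gcongr
    nlinarith

theorem normPDF_tendsto_atTop : Tendsto normPDF atTop (nhds 0) := by
  refine squeeze_zero' (Eventually.of_forall fun z => (normPDF_pos z).le) ?_
    mul_normPDF_tendsto_atTop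
  filter_upwards [eventually_ge_atTop 1] with z hz
  exact le_mul_of_one_le_left (normPDF_pos z).le hz

theorem normPDF_sq_div_tendsto_atTop :
    Tendsto (fun z => normPDF z ^ 2 / (1 - normCDF z)) atTop (nhds 0) := by
  have h : Tendsto (fun z => Real.exp 1 * normPDF (z - 1)) atTop (nhds 0) := by
    simpa [sub_eq_add_neg] using (normPDF_tendsto_atTop.comp
      (tendsto_atTop_add_const_right atTop (-1 : ℝ) tendsto_id)).const_mul (Real.exp 1)
  refine squeeze_zero' ?_ ?_ h
  all_goals
    filter_upwards [eventually_ge_atTop 0] with z hz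
    have hle := normPDF_add_one_le_one_sub_normCDF hz
    have hpos := (normPDF_pos (z + 1)).trans_le hle
  · positivity
  · rw [div_le_iff₀ hpos, normPDF_sq]
    have := normPDF_pos (z - 1)
    gcongr

/-- The censoring adjustment function tends to `1` as `z → +∞`. -/
theorem censorAdj_tendsto_atTop : Tendsto censorAdj atTop (nhds 1) := by
  have h := (normCDF_tendsto_atTop.sub mul_normPDF_tendsto_atTop).add normPDF_sq_div_tendsto_atTop
  rw [sub_zero, add_zero] at h
  exact h
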